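/- Let p ≥ 2 and α, θ ≥ 0. There exists a constant C > 0, depending only on α, p and θ, such that every u ∈ X^{1,p}_∞(α,θ) satisfies |u(r)|^p ≤ C r^{−(α+θ(p−1))/p} ‖u‖^p for all r > 0. Moreover, r^{(α+θ(p−1))/p} |u(r)|^p → 0 as r → ∞. -/

import Mathlib

open MeasureTheory Real Filter ENNReal

/-- The fractional-dimension spherical volume constant `ω_θ = 2π^((θ+1)/2)/Γ((θ+1)/2)`. -/
noncomputable def omegaW (θ : ℝ) : ℝ := 2 * Real.pi ^ ((θ + 1) / 2) / Real.Gamma ((θ + 1) / 2)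

/-- Weighted integral `∫₀^∞ f dλ_θ = ω_θ ∫₀^∞ f(r) r^θ dr` (for nonnegative integrands,
valued in `ℝ≥0∞`). -/
noncomputable def wInt (θ : ℝ) (f : ℝ → ℝ) : ℝ≥0∞ :=
  ENNReal.ofReal (omegaW θ) *
    ∫⁻ r in Set.Ioi (0 : ℝ), ENNReal.ofReal (f r) * ENNReal.ofReal (r ^ θ)

/-- The weighted Lebesgue norm `‖u‖_{L^q_θ}` (valued in `ℝ≥0∞`). -/
noncomputable def wNorm (θ q : ℝ) (u : ℝ → ℝ) : ℝ≥0∞ :=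
  (wInt θ fun r => |u r| ^ q) ^ (1 / q)

/-- Membership in the weighted Sobolev space `X = X^{1,p}_∞(α,θ)`:
`u` is locally absolutely continuous on `(0,∞)` with a.e. derivative `u'`
(expressed through the fundamental theorem of calculus on compact subintervals),
`u(r) → 0` as `r → ∞`, `‖u‖_{L^p_θ} < ∞` and `‖u'‖_{L^p_α} < ∞`. -/
structure MemX (p α θ : ℝ) (u u' : ℝ → ℝ) : Prop where
  ftc_int : ∀ a b : ℝ, 0 < a → a ≤ b → IntervalIntegrable u' MeasureTheory.volume a b
  ftc : ∀ a b : ℝ, 0 < a → a ≤ b → u b - u a = ∫ t in a..b, u' t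
  lim_zero : Filter.Tendsto u Filter.atTop (nhds 0)
  fin_u : wNorm θ p u < ⊤
  fin_u' : wNorm α p u' < ⊤

/-- Full norm on `X`: `‖u‖ = (‖u‖_{L^p_θ}^p + ‖u'‖_{L^p_α}^p)^{1/p}`. -/
noncomputable def Xnorm (p α θ : ℝ) (u u' : ℝ → ℝ) : ℝ≥0∞ :=
  ((wNorm θ p u) ^ p + (wNorm α p u') ^ p) ^ (1 / p)

/-- The truncated exponential `φ_p(t) = Σ_{j ∈ ℕ, j ≥ p-1} t^j / j!`. -/
noncomputable def phiP (p t : ℝ) : ℝ :=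
  ∑' j : ℕ, if p - 1 ≤ (j : ℝ) then t ^ j / (Nat.factorial j : ℝ) else 0

/-- The critical constant `μ_{α,θ} = (θ+1) ω_α^{1/α}`. -/
noncomputable def muC (α θ : ℝ) : ℝ := (θ + 1) * (omegaW α) ^ (1 / α)

/-- The Trudinger–Moser functional `∫₀^∞ φ_p(μ |u|^{p/(p-1)}) dλ_θ`. -/
noncomputable def TMfunc (p θ μ : ℝ) (u : ℝ → ℝ) : ℝ≥0∞ :=
  wInt θ fun r => phiP p (μ * |u r| ^ (p / (p - 1)))

/-- The subcritical Trudinger–Moser supremum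
`TMSC(μ,α,θ) = sup { ‖u‖_{L^p_θ}^{-p} ∫₀^∞ φ_p(μ|u|^{p/(p-1)}) dλ_θ : u ∈ X, u ≠ 0, ‖u'‖_{L^p_α} ≤ 1 }`. -/
noncomputable def TMSC (p α θ μ : ℝ) : ℝ≥0∞ :=
  ⨆ (u : ℝ → ℝ) (u' : ℝ → ℝ) (_ : MemX p α θ u u') (_ : u ≠ 0)
    (_ : wNorm α p u' ≤ 1), (wNorm θ p u) ^ (-p) * TMfunc p θ μ u

/-- The critical Trudinger–Moser supremum
`TMC(σ,α,θ) = sup { ∫₀^∞ φ_p(σ|u|^{p/(p-1)}) dλ_θ : u ∈ X, ‖u‖ ≤ 1 }`. -/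
noncomputable def TMC (p α θ σ : ℝ) : ℝ≥0∞ :=
  ⨆ (u : ℝ → ℝ) (u' : ℝ → ℝ) (_ : MemX p α θ u u') (_ : Xnorm p α θ u u' ≤ 1),
    TMfunc p θ σ u

/-- `k₀ = min { j ∈ ℕ : j ≥ p - 1 }`. -/
noncomputable def k0 (p : ℝ) : ℕ := sInf {j : ℕ | p - 1 ≤ (j : ℝ)}

/-- `TMC(σ,α,θ)` is attained by some `u ∈ X` with `‖u‖ ≤ 1`. -/
def TMCAttained (p α θ σ : ℝ) : Prop :=
  ∃ u u' : ℝ → ℝ, MemX p α θ u u' ∧ Xnorm p α θ u u' ≤ 1 ∧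
    TMC p α θ σ = TMfunc p θ σ u

/-- `σ_* = inf { σ ∈ (0, μ_{α,θ}) : TMC(σ,α,θ) is attained }`. -/
noncomputable def sigmaStar (p α θ : ℝ) : ℝ :=
  sInf {σ : ℝ | σ ∈ Set.Ioo 0 (muC α θ) ∧ TMCAttained p α θ σ}

open Set Topology

/-- Post-composition with a Lipschitz map preserves absolute continuity. -/
lemma AbsolutelyContinuousOnInterval.lipschitzOnWith_comp {u φ : ℝ → ℝ} {a b : ℝ} {s : Set ℝ}
    {K : NNReal} (hu : AbsolutelyContinuousOnInterval u a b) (hφ : LipschitzOnWith K φ s)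
    (hus : MapsTo u (uIcc a b) s) : AbsolutelyContinuousOnInterval (fun x => φ (u x)) a b := by
  rw [absolutelyContinuousOnInterval_iff] at hu ⊢
  intro ε hε
  obtain ⟨δ, hδ, h⟩ := hu (ε / (K + 1)) (by positivity)
  refine ⟨δ, hδ, fun E hE hEδ => ?_⟩
  calc ∑ i ∈ Finset.range E.1, dist (φ (u (E.2 i).1)) (φ (u (E.2 i).2))
      ≤ ∑ i ∈ Finset.range E.1, (K + 1) * dist (u (E.2 i).1) (u (E.2 i).2) := by
        refine Finset.sum_le_sum fun i hi => ?_
        have hi' := hE.1 i hi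
        refine (hφ.dist_le_mul _ (hus hi'.1) _ (hus hi'.2)).trans ?_
        gcongr
        linarith
    _ = (K + 1) * ∑ i ∈ Finset.range E.1, dist (u (E.2 i).1) (u (E.2 i).2) :=
        (Finset.mul_sum _ _ _).symm
    _ < (K + 1) * (ε / (K + 1)) := by
        have := h E hE hEδ
        gcongr
    _ = ε := by field_simp

lemma AbsolutelyContinuousOnInterval.abs_rpow {u : ℝ → ℝ} {a b p : ℝ} (hp : 1 < p)
    (hu : AbsolutelyContinuousOnInterval u a b) :
    AbsolutelyContinuousOnInterval (fun x => |u x| ^ p) a b := by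
  obtain ⟨M, hM⟩ := hu.exists_bound
  have hφ : ContDiff ℝ 1 (fun x : ℝ => |x| ^ p) := by
    simpa only [Real.norm_eq_abs] using contDiff_norm_rpow (E := ℝ) hp
  obtain ⟨K, hK⟩ := (hφ.contDiffOn (s := Icc (-M) M)).exists_lipschitzOnWith one_ne_zero
    (convex_Icc _ _) isCompact_Icc
  have hmaps : MapsTo u (uIcc a b) (Icc (-M) M) := by
    intro x hx
    exact mem_Icc.mpr (abs_le.mp (hM x hx))
  exact hu.lipschitzOnWith_comp (φ := fun x => |x| ^ p) hK hmaps

namespace MemX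

variable {p α θ : ℝ} {u u' : ℝ → ℝ}

lemma eq_add_integral (h : MemX p α θ u u') {a b : ℝ} (ha : 0 < a) (hab : a ≤ b) :
    u b = u a + ∫ t in a..b, u' t := by
  linarith [h.ftc a b ha hab]

lemma absolutelyContinuousOnInterval (h : MemX p α θ u u') {a b : ℝ} (ha : 0 < a) (hab : a ≤ b) :
    AbsolutelyContinuousOnInterval u a b := by
  have h1 := (h.ftc_int a b ha hab).absolutelyContinuousOnInterval_intervalIntegral
    (c := a) (by simp)
  have h2 : AbsolutelyContinuousOnInterval (fun _ : ℝ => u a) a b :=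
    (LipschitzWith.const (u a)).lipschitzOnWith.absolutelyContinuousOnInterval
  have h3 := h2.fun_add h1
  rw [absolutelyContinuousOnInterval_iff] at h3 ⊢
  intro ε hε
  obtain ⟨δ, hδ, H⟩ := h3 ε hε
  refine ⟨δ, hδ, fun E hE hEδ => ?_⟩
  convert! H E hE hEδ using 1
  refine Finset.sum_congr rfl fun i hi => ?_
  have hi' := hE.1 i hi
  rw [uIcc_of_le hab] at hi'
  rw [h.eq_add_integral ha hi'.1.1, h.eq_add_integral ha hi'.2.1]

lemma ae_hasDerivAt (h : MemX p α θ u u') {a b : ℝ} (ha : 0 < a) (hab : a ≤ b) :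
    ∀ᵐ x, x ∈ Ioc a b → HasDerivAt u (u' x) x := by
  have hb : ∀ᵐ x : ℝ, x ≠ b := by simp [ae_iff, measure_singleton]
  filter_upwards [(h.ftc_int a b ha hab).ae_hasDerivAt_integral, hb] with x hx hxb hxI
  rw [uIcc_of_le hab] at hx
  have hd := (hx (Ioc_subset_Icc_self hxI) a (left_mem_Icc.mpr hab)).const_add (u a)
  refine hd.congr_of_eventuallyEq ?_
  filter_upwards [Ioi_mem_nhds hxI.1] with y hy
  exact h.eq_add_integral ha hy.le

lemma continuousOn (h : MemX p α θ u u') : ContinuousOn u (Ioi 0) := by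
  intro x hx
  have hx0 : 0 < x := hx
  have hc := (h.absolutelyContinuousOnInterval (half_pos hx0)
    (by linarith : x / 2 ≤ 2 * x)).continuousOn
  rw [uIcc_of_le (by linarith)] at hc
  exact (hc.continuousAt (Icc_mem_nhds (by linarith) (by linarith))).continuousWithinAt

lemma enorm_sub_abs_rpow_le (h : MemX p α θ u u') (hp : 1 < p) {a b : ℝ} (ha : 0 < a)
    (hab : a ≤ b) :
    ‖|u b| ^ p - |u a| ^ p‖ₑ ≤ ∫⁻ t in Ioc a b, ENNReal.ofReal (p * (|u t| ^ (p - 1) * |u' t|)) := by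
  rw [← ((h.absolutelyContinuousOnInterval ha hab).abs_rpow hp).integral_deriv_eq_sub,
    intervalIntegral.integral_of_le hab]
  refine (enorm_integral_le_lintegral_enorm _).trans ?_
  refine setLIntegral_mono_ae' measurableSet_Ioc ?_
  filter_upwards [h.ae_hasDerivAt ha hab] with x hx hxI
  have hd := (hasDerivAt_abs_rpow (u x) hp).comp x (hx hxI)
  have hd' : deriv (fun x => |u x| ^ p) x = p * |u x| ^ (p - 2) * u x * u' x := hd.deriv
  rw [hd', ← ofReal_norm]
  refine ENNReal.ofReal_le_ofReal (le_of_eq ?_)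
  have h1 : |u x| ^ (p - 1) = |u x| ^ (p - 2) * |u x| := by
    rw [← Real.rpow_add_one' (abs_nonneg _) (by linarith)]
    ring_nf
  rw [h1]
  simp only [norm_mul, Real.norm_eq_abs, abs_of_pos (by linarith : 0 < p),
    abs_of_nonneg (Real.rpow_nonneg (abs_nonneg (u x)) _)]
  ring

end MemX

/-- The sum of the two weighted energy densities of `u` and `u'`. -/
noncomputable def energyDensity (p α θ : ℝ) (u u' : ℝ → ℝ) (t : ℝ) : ℝ≥0∞ :=
  ENNReal.ofReal (|u t| ^ p) * ENNReal.ofReal (t ^ θ) +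
    ENNReal.ofReal (|u' t| ^ p) * ENNReal.ofReal (t ^ α)

lemma rpow_sub_one_mul_le_add {p a b : ℝ} (hp : 1 ≤ p) (ha : 0 ≤ a) (hb : 0 ≤ b) :
    a ^ (p - 1) * b ≤ a ^ p + b ^ p := by
  have key : ∀ c : ℝ, 0 ≤ c → c ^ (p - 1) * c = c ^ p := fun c hc => by
    rw [← Real.rpow_add_one' hc (by linarith)]
    ring_nf
  rcases le_total a b with hab | hab
  · calc a ^ (p - 1) * b ≤ b ^ (p - 1) * b := by
          gcongr
      _ = b ^ p := key b hb
      _ ≤ a ^ p + b ^ p := by linarith [Real.rpow_nonneg ha p]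
  · calc a ^ (p - 1) * b ≤ a ^ (p - 1) * a := by gcongr
      _ = a ^ p := key a ha
      _ ≤ a ^ p + b ^ p := by linarith [Real.rpow_nonneg hb p]

lemma weighted_rpow_sub_one_mul_le {p α θ x y r t : ℝ} (hp : 1 ≤ p) (hα : 0 ≤ α) (hθ : 0 ≤ θ)
    (hx : 0 ≤ x) (hy : 0 ≤ y) (hr : 0 < r) (hrt : r ≤ t) :
    x ^ (p - 1) * y ≤ r ^ (-((α + θ * (p - 1)) / p)) * (x ^ p * t ^ θ + y ^ p * t ^ α) := by
  have ht : 0 < t := hr.trans_le hrt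
  have hp0 : 0 < p := by linarith
  have hβ : 0 ≤ (α + θ * (p - 1)) / p :=
    div_nonneg (add_nonneg hα (mul_nonneg hθ (by linarith))) hp0.le
  have key := rpow_sub_one_mul_le_add hp
    (mul_nonneg hx (Real.rpow_nonneg ht.le (θ / p)))
    (mul_nonneg hy (Real.rpow_nonneg ht.le (α / p)))
  rw [Real.mul_rpow hx (by positivity), Real.mul_rpow hx (by positivity),
    Real.mul_rpow hy (by positivity), ← Real.rpow_mul ht.le, ← Real.rpow_mul ht.le,
    ← Real.rpow_mul ht.le, div_mul_cancel₀ _ hp0.ne', div_mul_cancel₀ _ hp0.ne'] at key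
  have e : t ^ (-((α + θ * (p - 1)) / p)) * (t ^ (θ / p * (p - 1)) * t ^ (α / p)) = 1 := by
    rw [← Real.rpow_add ht, ← Real.rpow_add ht, ← Real.rpow_zero t]
    congr 1
    field_simp
    ring
  calc x ^ (p - 1) * y
      = t ^ (-((α + θ * (p - 1)) / p)) *
          (x ^ (p - 1) * t ^ (θ / p * (p - 1)) * (y * t ^ (α / p))) := by
        linear_combination (-(x ^ (p - 1) * y)) * e
    _ ≤ t ^ (-((α + θ * (p - 1)) / p)) * (x ^ p * t ^ θ + y ^ p * t ^ α) := by gcongr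
    _ ≤ r ^ (-((α + θ * (p - 1)) / p)) * (x ^ p * t ^ θ + y ^ p * t ^ α) := by
        have := Real.rpow_le_rpow_of_nonpos hr hrt (neg_nonpos.mpr hβ)
        gcongr

namespace MemX

variable {p α θ : ℝ} {u u' : ℝ → ℝ}

lemma ofReal_abs_rpow_le (h : MemX p α θ u u') (hp : 1 < p) (hα : 0 ≤ α) (hθ : 0 ≤ θ) {r : ℝ}
    (hr : 0 < r) :
    ENNReal.ofReal (|u r| ^ p) ≤
      ENNReal.ofReal (p * r ^ (-((α + θ * (p - 1)) / p))) *
        ∫⁻ t in Ioi r, energyDensity p α θ u u' t := by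
  have hlim : Tendsto (fun b => ‖|u b| ^ p - |u r| ^ p‖ₑ) atTop (𝓝 (ENNReal.ofReal (|u r| ^ p))) := by
    have h0 : Tendsto (fun b => |u b| ^ p) atTop (𝓝 0) := by
      have := (h.lim_zero.abs).rpow_const (p := p) (Or.inr (by linarith))
      simpa [Real.zero_rpow (by linarith : p ≠ 0)] using this
    have h1 := (h0.sub_const (|u r| ^ p)).enorm
    rwa [zero_sub, enorm_neg, Real.enorm_of_nonneg (by positivity)] at h1
  refine le_of_tendsto hlim ?_
  filter_upwards [eventually_ge_atTop r] with b hb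
  refine (h.enorm_sub_abs_rpow_le hp hr hb).trans ?_
  rw [← lintegral_const_mul' _ _ ENNReal.ofReal_ne_top]
  refine (lintegral_mono_set Ioc_subset_Ioi_self).trans ?_
  refine setLIntegral_mono' measurableSet_Ioi fun t ht => ?_
  have ht0 : 0 < t := hr.trans ht
  rw [energyDensity, ← ENNReal.ofReal_mul (by positivity), ← ENNReal.ofReal_mul (by positivity),
    ← ENNReal.ofReal_add (by positivity) (by positivity), ← ENNReal.ofReal_mul (by positivity)]
  refine ENNReal.ofReal_le_ofReal ?_
  rw [mul_assoc]
  exact mul_le_mul_of_nonneg_left (weighted_rpow_sub_one_mul_le hp.le hα hθ (abs_nonneg _)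
    (abs_nonneg _) hr (le_of_lt ht)) (by linarith)

end MemX

lemma omegaW_pos {θ : ℝ} (hθ : 0 ≤ θ) : 0 < omegaW θ :=
  div_pos (by positivity) (Real.Gamma_pos_of_pos (by linarith))

lemma wNorm_rpow {p : ℝ} (hp : 0 < p) (θ : ℝ) (u : ℝ → ℝ) :
    wNorm θ p u ^ p = wInt θ fun r => |u r| ^ p := by
  rw [wNorm, ← ENNReal.rpow_mul, one_div_mul_cancel hp.ne', ENNReal.rpow_one]

lemma Xnorm_rpow {p : ℝ} (hp : 0 < p) (α θ : ℝ) (u u' : ℝ → ℝ) :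
    Xnorm p α θ u u' ^ p = (wInt θ fun r => |u r| ^ p) + wInt α fun r => |u' r| ^ p := by
  rw [Xnorm, ← ENNReal.rpow_mul, one_div_mul_cancel hp.ne', ENNReal.rpow_one, wNorm_rpow hp,
    wNorm_rpow hp]

lemma setLIntegral_eq_ofReal_inv_mul_wInt {θ : ℝ} (hθ : 0 ≤ θ) (f : ℝ → ℝ) :
    ∫⁻ r in Ioi (0 : ℝ), ENNReal.ofReal (f r) * ENNReal.ofReal (r ^ θ) =
      ENNReal.ofReal (omegaW θ)⁻¹ * wInt θ f := by
  rw [wInt, ← mul_assoc, ← ENNReal.ofReal_mul (inv_nonneg.mpr (omegaW_pos hθ).le),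
    inv_mul_cancel₀ (omegaW_pos hθ).ne', ENNReal.ofReal_one, one_mul]

namespace MemX

variable {p α θ : ℝ} {u u' : ℝ → ℝ}

lemma Xnorm_rpow_ne_top (h : MemX p α θ u u') (hp : 0 < p) : Xnorm p α θ u u' ^ p ≠ ⊤ := by
  rw [Xnorm_rpow hp, ← wNorm_rpow hp, ← wNorm_rpow hp]
  exact ENNReal.add_ne_top.mpr ⟨ENNReal.rpow_ne_top_of_nonneg hp.le h.fin_u.ne,
    ENNReal.rpow_ne_top_of_nonneg hp.le h.fin_u'.ne⟩

lemma lintegral_energyDensity_le (h : MemX p α θ u u') (hp : 0 < p) (hα : 0 ≤ α) (hθ : 0 ≤ θ) :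
    ∫⁻ t in Ioi (0 : ℝ), energyDensity p α θ u u' t ≤
      ENNReal.ofReal ((omegaW θ)⁻¹ + (omegaW α)⁻¹) * Xnorm p α θ u u' ^ p := by
  have hu : AEMeasurable u (volume.restrict (Ioi 0)) := h.continuousOn.aemeasurable measurableSet_Ioi
  have hm : AEMeasurable (fun t => ENNReal.ofReal (|u t| ^ p) * ENNReal.ofReal (t ^ θ))
      (volume.restrict (Ioi 0)) := by fun_prop
  have h1 := inv_nonneg.mpr (omegaW_pos hθ).le
  have h2 := inv_nonneg.mpr (omegaW_pos hα).le
  simp only [energyDensity]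
  rw [lintegral_add_left' hm, setLIntegral_eq_ofReal_inv_mul_wInt hθ (fun t => |u t| ^ p),
    setLIntegral_eq_ofReal_inv_mul_wInt hα (fun t => |u' t| ^ p), Xnorm_rpow hp, mul_add]
  gcongr <;> linarith

lemma tendsto_lintegral_energyDensity (h : MemX p α θ u u') (hp : 0 < p) (hα : 0 ≤ α)
    (hθ : 0 ≤ θ) :
    Tendsto (fun r => ∫⁻ t in Ioi r, energyDensity p α θ u u' t) atTop (𝓝 0) := by
  set ν := (volume.restrict (Ioi 0)).withDensity (energyDensity p α θ u u')
  have hfin : ∫⁻ t in Ioi (0 : ℝ), energyDensity p α θ u u' t ≠ ⊤ :=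
    ((h.lintegral_energyDensity_le hp hα hθ).trans_lt
      (ENNReal.mul_lt_top ENNReal.ofReal_lt_top (h.Xnorm_rpow_ne_top hp).lt_top)).ne
  have : IsFiniteMeasure ν := isFiniteMeasure_withDensity hfin
  have hν := tendsto_measure_iInter_atTop (μ := ν) (s := fun r : ℝ => Ioi r)
    (fun r => measurableSet_Ioi.nullMeasurableSet) (fun _ _ hab => Ioi_subset_Ioi hab)
    ⟨0, measure_ne_top _ _⟩
  have hempty : ⋂ r : ℝ, Ioi r = ∅ :=
    eq_empty_of_forall_notMem fun x hx => lt_irrefl x (mem_iInter.mp hx x)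
  rw [hempty, measure_empty] at hν
  refine hν.congr' ?_
  filter_upwards [eventually_ge_atTop 0] with r hr
  simp only [ν, Function.comp_apply]
  rw [withDensity_apply _ measurableSet_Ioi, Measure.restrict_restrict measurableSet_Ioi,
    inter_eq_left.mpr (Ioi_subset_Ioi hr)]

end MemX

theorem stmt_14 (p α θ : ℝ) (hp : 2 ≤ p) (hα : 0 ≤ α) (hθ : 0 ≤ θ) :
    ∃ C : ℝ, 0 < C ∧ ∀ u u' : ℝ → ℝ, MemX p α θ u u' →
      (∀ r : ℝ, 0 < r →
        |u r| ^ p ≤ C * r ^ (-((α + θ * (p - 1)) / p)) * ((Xnorm p α θ u u').toReal) ^ p) ∧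
      Filter.Tendsto (fun r : ℝ => r ^ ((α + θ * (p - 1)) / p) * |u r| ^ p)
        Filter.atTop (nhds 0) := by
  have hp0 : 0 < p := by linarith
  have hω : 0 < (omegaW θ)⁻¹ + (omegaW α)⁻¹ :=
    add_pos (inv_pos.mpr (omegaW_pos hθ)) (inv_pos.mpr (omegaW_pos hα))
  refine ⟨p * ((omegaW θ)⁻¹ + (omegaW α)⁻¹), by positivity, fun u u' h => ⟨fun r hr => ?_, ?_⟩⟩
  · have hle : ENNReal.ofReal (|u r| ^ p) ≤ ENNReal.ofReal (p * r ^ (-((α + θ * (p - 1)) / p))) *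
        (ENNReal.ofReal ((omegaW θ)⁻¹ + (omegaW α)⁻¹) * Xnorm p α θ u u' ^ p) := by
      refine (h.ofReal_abs_rpow_le (by linarith) hα hθ hr).trans ?_
      gcongr
      exact (lintegral_mono_set (Ioi_subset_Ioi hr.le)).trans
        (h.lintegral_energyDensity_le hp0 hα hθ)
    have htop := ENNReal.mul_ne_top (ENNReal.ofReal_ne_top (r := p * r ^ (-((α + θ * (p - 1)) / p))))
      (ENNReal.mul_ne_top (ENNReal.ofReal_ne_top (r := (omegaW θ)⁻¹ + (omegaW α)⁻¹))
        (h.Xnorm_rpow_ne_top hp0))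
    have hreal := ENNReal.toReal_mono htop hle
    rw [ENNReal.toReal_ofReal (by positivity), ENNReal.toReal_mul, ENNReal.toReal_mul,
      ENNReal.toReal_ofReal (by positivity), ENNReal.toReal_ofReal hω.le,
      ← ENNReal.toReal_rpow] at hreal
    linarith
  · have htail := ENNReal.Tendsto.const_mul (a := ENNReal.ofReal p)
      (h.tendsto_lintegral_energyDensity hp0 hα hθ) (Or.inr ENNReal.ofReal_ne_top)
    rw [mul_zero] at htail
    have hlim : Tendsto (fun r : ℝ => ENNReal.ofReal (r ^ ((α + θ * (p - 1)) / p) * |u r| ^ p))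
        atTop (𝓝 0) := by
      refine tendsto_of_tendsto_of_tendsto_of_le_of_le' tendsto_const_nhds htail
        (Eventually.of_forall fun _ => zero_le) ?_
      filter_upwards [eventually_gt_atTop 0] with r hr
      have hle := h.ofReal_abs_rpow_le (by linarith) hα hθ hr
      rw [ENNReal.ofReal_mul (by positivity)]
      refine (mul_le_mul_right hle _).trans (le_of_eq ?_)
      rw [← mul_assoc, ← ENNReal.ofReal_mul (by positivity), mul_left_comm, ← Real.rpow_add hr,
        add_neg_cancel, Real.rpow_zero, mul_one]
    have hreal := (ENNReal.tendsto_toReal ENNReal.zero_ne_top).comp hlim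
    refine hreal.congr' ?_
    filter_upwards [eventually_gt_atTop 0] with r hr
    exact ENNReal.toReal_ofReal (by positivity)
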